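/- Let a ≥ 2 be an integer. Define h(t) as the coefficient of x^t in (1+x+…+x^{a−1})³ for 0 ≤ t ≤ 3a−3, and h_I(t) = max(h(t) − h(t−a), 0). Then h_I(t) = 0 for t ≥ 2a−1, and moreover the alternating Betti number consistency holds: Σ_{t≥0} h_I(t)·x^t · (1−x)³ = 1 − 4x^a + 3x^{2a} + a·x^{2a−1} − a·x^{2a+1} as polynomials. -/

import Mathlib

open Finset Polynomial

lemma aux_choose (n : ℕ) : 2 * (((n + 2).choose 2 : ℕ) : ℤ) = (n + 1) * (n + 2) := by
  induction n with
  | zero => simp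
  | succ n ih =>
    have : (n + 1 + 2).choose 2 = (n + 2).choose 1 + (n + 2).choose 2 := rfl
    rw [this]
    push_cast [Nat.choose_one_right]
    linarith

lemma aux_sum (n : ℕ) :
    2 * ((∑ t ∈ Finset.range n, C (((t + 2).choose 2 : ℕ) : ℤ) * (X : ℤ[X]) ^ t) * (1 - X) ^ 3) =
      2 - ((n : ℤ[X]) + 1) * ((n : ℤ[X]) + 2) * X ^ n
        + 2 * (n : ℤ[X]) * ((n : ℤ[X]) + 2) * X ^ (n + 1)
        - (n : ℤ[X]) * ((n : ℤ[X]) + 1) * X ^ (n + 2) := by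
  induction n with
  | zero => simp
  | succ n ih =>
    rw [Finset.sum_range_succ, add_mul, mul_add, ih]
    have h2 := congrArg (C : ℤ → ℤ[X]) (aux_choose n)
    simp only [map_mul, map_add, map_natCast, map_one, map_ofNat] at h2
    have : 2 * (C (((n + 2).choose 2 : ℕ) : ℤ) * (X : ℤ[X]) ^ n * (1 - X) ^ 3)
        = (((n : ℤ[X]) + 1) * ((n : ℤ[X]) + 2)) * (X ^ n * (1 - X) ^ 3) := by
      rw [← h2]; simp only [map_natCast]; ring
    rw [this]
    push_cast
    ring

lemma aux_coeff (a t : ℕ) :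
    (((∑ k ∈ Finset.range a, (X : ℤ[X]) ^ k) ^ 3) * (1 - X ^ a)).coeff t =
      (((t + 2).choose 2 : ℕ) : ℤ)
      - 4 * (if a ≤ t then (((t - a + 2).choose 2 : ℕ) : ℤ) else 0)
      + 6 * (if 2 * a ≤ t then (((t - 2 * a + 2).choose 2 : ℕ) : ℤ) else 0)
      - 4 * (if 3 * a ≤ t then (((t - 3 * a + 2).choose 2 : ℕ) : ℤ) else 0)
      + (if 4 * a ≤ t then (((t - 4 * a + 2).choose 2 : ℕ) : ℤ) else 0) := by
  set P : ℤ[X] := (∑ k ∈ Finset.range a, (X : ℤ[X]) ^ k) ^ 3 * (1 - X ^ a) with hP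
  have h1 : P * (1 - X) ^ 3 = (1 - X ^ a) ^ 4 := by
    have := geom_sum_mul_neg (X : ℤ[X]) a
    rw [hP, mul_right_comm, ← mul_pow, this]; ring
  have h2 := congrArg (fun p : ℤ[X] => (p : PowerSeries ℤ)) h1
  simp only [Polynomial.coe_mul, Polynomial.coe_pow, Polynomial.coe_sub, Polynomial.coe_one,
    Polynomial.coe_X] at h2
  have h3 : (1 - PowerSeries.X : PowerSeries ℤ) ^ 3 *
      PowerSeries.mk (fun n => (((n + 2).choose 2 : ℕ) : ℤ)) = 1 := by
    have e := PowerSeries.mk_one_pow_eq_mk_choose_add ℤ 2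
    have : (PowerSeries.mk (fun n => (((n + 2).choose 2 : ℕ) : ℤ))) = 
      (PowerSeries.mk 1 : PowerSeries ℤ) ^ 3 := by
      rw [e]; ext n; simp [add_comm]
    rw [this, ← mul_pow, mul_comm, PowerSeries.mk_one_mul_one_sub_eq_one, one_pow]
  set M := PowerSeries.mk (fun n => (((n + 2).choose 2 : ℕ) : ℤ)) with hM
  have h4 : (P : PowerSeries ℤ) = M - 4 * (PowerSeries.X ^ a * M) + 6 * (PowerSeries.X ^ (2 * a) * M)
      - 4 * (PowerSeries.X ^ (3 * a) * M) + PowerSeries.X ^ (4 * a) * M := by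
    calc (P : PowerSeries ℤ) = (P : PowerSeries ℤ) * (1 - PowerSeries.X) ^ 3 * M := by rw [mul_assoc, h3, mul_one]
      _ = _ := by rw [h2]; ring
  rw [← Polynomial.coeff_coe, h4]
  have c4 : (4 : PowerSeries ℤ) = PowerSeries.C (4 : ℤ) := by simp
  have c6 : (6 : PowerSeries ℤ) = PowerSeries.C (6 : ℤ) := by simp
  rw [c4, c6]
  simp only [map_add, map_sub, PowerSeries.coeff_C_mul, PowerSeries.coeff_X_pow_mul', hM,
    PowerSeries.coeff_mk]

lemma aux_nonneg (a t : ℕ) (ht : t < 2 * a - 1) :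
    0 ≤ (((t + 2).choose 2 : ℕ) : ℤ)
      - 4 * (if a ≤ t then (((t - a + 2).choose 2 : ℕ) : ℤ) else 0) := by
  have e0 := aux_choose t
  split_ifs with h
  · obtain ⟨s, rfl⟩ := Nat.exists_eq_add_of_le h
    have e1 := aux_choose s
    simp only [Nat.add_sub_cancel_left]
    push_cast at e0
    have hs : (s : ℤ) + 2 ≤ a := by omega
    nlinarith
  · rw [mul_zero, sub_zero]; positivity

lemma aux_nonpos (a t : ℕ) (ha : 2 ≤ a) (ht : 2 * a - 1 ≤ t) :
    (((t + 2).choose 2 : ℕ) : ℤ)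
      - 4 * (if a ≤ t then (((t - a + 2).choose 2 : ℕ) : ℤ) else 0)
      + 6 * (if 2 * a ≤ t then (((t - 2 * a + 2).choose 2 : ℕ) : ℤ) else 0)
      - 4 * (if 3 * a ≤ t then (((t - 3 * a + 2).choose 2 : ℕ) : ℤ) else 0)
      + (if 4 * a ≤ t then (((t - 4 * a + 2).choose 2 : ℕ) : ℤ) else 0) ≤ 0 := by
  have e0 := aux_choose t
  have e1 := aux_choose (t - a)
  have e2 := aux_choose (t - 2 * a)
  have e3 := aux_choose (t - 3 * a)
  have e4 := aux_choose (t - 4 * a)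
  have ha' : (2 : ℤ) ≤ a := by exact_mod_cast ha
  rw [if_pos (by omega : a ≤ t)]
  rw [Nat.cast_sub (by omega : a ≤ t)] at e1
  by_cases h2 : 2 * a ≤ t
  · rw [Nat.cast_sub h2] at e2
    rw [if_pos h2]
    by_cases h3 : 3 * a ≤ t
    · rw [Nat.cast_sub h3] at e3
      rw [if_pos h3]
      by_cases h4 : 4 * a ≤ t
      · rw [Nat.cast_sub h4] at e4
        rw [if_pos h4]
        push_cast at *
        linarith
      · rw [if_neg h4]
        push_cast at *
        have : (0 : ℤ) ≤ (4 * a - t - 1) * (4 * a - t - 2) := by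
          rcases (by omega : t + 1 = 4 * a ∨ t + 2 ≤ 4 * a) with h | h
          · have : (t : ℤ) = 4 * a - 1 := by omega
            rw [this]; ring_nf; norm_num
          · have : (t : ℤ) + 2 ≤ 4 * a := by omega
            apply mul_nonneg <;> linarith
        linarith
    · rw [if_neg h3, if_neg (by omega)]
      obtain ⟨s, rfl⟩ := Nat.exists_eq_add_of_le h2
      have hs : (s : ℤ) + 1 ≤ a := by omega
      have hs0 : (0 : ℤ) ≤ s := by positivity
      push_cast at *
      nlinarith [mul_nonneg hs0 (sub_nonneg.2 hs)]
  · rw [if_neg h2, if_neg (by omega), if_neg (by omega)]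
    have : (t : ℤ) = 2 * a - 1 := by omega
    rw [this] at e0 e1
    nlinarith

/-- Let a ≥ 2, let h(t) be the coefficient of x^t in
(1+x+…+x^{a−1})³ and h_I(t) = max(h(t) − h(t−a), 0).  Then h_I(t) = 0 for
t ≥ 2a−1 and (Σ_{t≥0} h_I(t)·x^t)·(1−x)³ =
1 − 4x^a + 3x^{2a} + a·x^{2a−1} − a·x^{2a+1}. -/
theorem stmt_17 (a : ℕ) (ha : 2 ≤ a)
    (h : ℤ → ℤ)
    (hh : ∀ t : ℤ, h t =
      if 0 ≤ t then
        ((∑ k ∈ Finset.range a, (Polynomial.X : Polynomial ℤ) ^ k) ^ 3).coeff t.toNat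
      else 0)
    (hI : ℤ → ℤ)
    (hhI : ∀ t : ℤ, hI t = max (h t - h (t - (a : ℤ))) 0) :
    (∀ t : ℤ, 2 * (a : ℤ) - 1 ≤ t → hI t = 0) ∧
    (∑ t ∈ Finset.range (2 * a - 1), Polynomial.C (hI t) * Polynomial.X ^ t) *
        (1 - Polynomial.X) ^ 3 =
      1 - Polynomial.C 4 * Polynomial.X ^ a + Polynomial.C 3 * Polynomial.X ^ (2 * a) +
        Polynomial.C (a : ℤ) * Polynomial.X ^ (2 * a - 1) -
        Polynomial.C (a : ℤ) * Polynomial.X ^ (2 * a + 1) := by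
  have hd : ∀ t : ℕ, h t - h ((t : ℤ) - a) =
      (((∑ k ∈ Finset.range a, (X : ℤ[X]) ^ k) ^ 3) * (1 - X ^ a)).coeff t := by
    intro t
    rw [mul_sub, mul_one, coeff_sub, coeff_mul_X_pow', hh, hh]
    rw [if_pos (by positivity), Int.toNat_natCast]
    by_cases hat : a ≤ t
    · rw [if_pos hat, if_pos (by omega), show ((t : ℤ) - a).toNat = t - a by omega]
    · rw [if_neg hat, if_neg (by omega)]
  constructor
  · intro t ht
    lift t to ℕ using by omega
    rw [hhI, hd, aux_coeff]
    exact max_eq_right (aux_nonpos a t ha (by omega))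
  · have key : (∑ t ∈ Finset.range (2 * a - 1), C (hI t) * (X : ℤ[X]) ^ t) =
        (∑ t ∈ Finset.range (2 * a - 1), C (((t + 2).choose 2 : ℕ) : ℤ) * (X : ℤ[X]) ^ t)
        - 4 * X ^ a *
          (∑ t ∈ Finset.range (a - 1), C (((t + 2).choose 2 : ℕ) : ℤ) * (X : ℤ[X]) ^ t) := by
      have s2 : 4 * X ^ a *
          (∑ t ∈ Finset.range (a - 1), C (((t + 2).choose 2 : ℕ) : ℤ) * (X : ℤ[X]) ^ t) =
          ∑ t ∈ Finset.range (2 * a - 1),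
            4 * (C (if a ≤ t then (((t - a + 2).choose 2 : ℕ) : ℤ) else 0) * (X : ℤ[X]) ^ t) := by
        rw [show 2 * a - 1 = a + (a - 1) by omega, Finset.sum_range_add, Finset.mul_sum]
        rw [Finset.sum_eq_zero (s := Finset.range a), zero_add]
        · refine Finset.sum_congr rfl fun t _ => ?_
          rw [if_pos (by omega), Nat.add_sub_cancel_left, pow_add]
          ring
        · intro t ht
          rw [if_neg (by simpa using ht)]
          simp
      rw [s2, ← Finset.sum_sub_distrib]
      refine Finset.sum_congr rfl fun t ht => ?_
      have ht' : t < 2 * a - 1 := by simpa using ht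
      have := aux_nonneg a t ht'
      rw [hhI, hd, aux_coeff, if_neg (by omega : ¬ 2 * a ≤ t), if_neg (by omega : ¬ 3 * a ≤ t),
        if_neg (by omega : ¬ 4 * a ≤ t), mul_zero, mul_zero, add_zero, sub_zero, add_zero,
        max_eq_left this, C_sub, C_mul, sub_mul, mul_assoc (C 4)]
      simp only [map_ofNat]
    have two : (2 : ℤ[X]) ≠ 0 := by norm_num
    apply mul_left_cancel₀ two
    have q1 := aux_sum (2 * a - 1)
    have q2 := aux_sum (a - 1)
    rw [key]
    obtain ⟨b, rfl⟩ : ∃ b, a = b + 1 := ⟨a - 1, by omega⟩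
    rw [show 2 * (b + 1) - 1 = 2 * b + 1 by omega] at *
    rw [Nat.add_sub_cancel] at *
    rw [sub_mul, mul_sub, q1, mul_assoc (4 * X ^ (b + 1)), mul_left_comm, q2]
    simp only [map_ofNat, map_natCast]
    push_cast
    ring
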